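/- Let d ≥ 2 be an integer and α ∈ (0,2). Then the integral over the open unit ball B(0,1) ⊂ ℝ^d of the radial function y ↦ |y|^{α-d} (1 - I(|y|^2; d/2-α/2, α/2)) equals (2π^{d/2}/Γ(d/2)) · ∫_0^1 r^{α-1} (1 - I(r^2; d/2-α/2, α/2)) dr, and hence equals (2π^{d/2}/Γ(d/2)) · Γ(d/2)^2 / (α Γ(d/2-α/2) Γ(d/2+α/2)). -/

import Mathlib

open Real MeasureTheory

/-- Beta function B(z,w) = Γ(z)Γ(w)/Γ(z+w). -/
noncomputable def betaFn (z w : ℝ) : ℝ :=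
  Real.Gamma z * Real.Gamma w / Real.Gamma (z + w)

/-- Regularized incomplete Beta function I(x; z, w). -/
noncomputable def regIncBeta (x z w : ℝ) : ℝ :=
  (∫ u in (0:ℝ)..x, u ^ (z - 1) * (1 - u) ^ (w - 1)) / betaFn z w

/-- The integrand of the Beta function. -/
noncomputable def betaIntegrand (z w u : ℝ) : ℝ :=
  u ^ (z - 1) * (1 - u) ^ (w - 1)

lemma ofReal_betaIntegrand (z w : ℝ) {u : ℝ} (hu : u ∈ Set.Icc (0 : ℝ) 1) :
    ((betaIntegrand z w u : ℝ) : ℂ) = (u : ℂ) ^ ((z : ℂ) - 1) * (1 - (u : ℂ)) ^ ((w : ℂ) - 1) := by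
  rw [betaIntegrand, Complex.ofReal_mul, Complex.ofReal_cpow hu.1,
    Complex.ofReal_cpow (sub_nonneg.2 hu.2)]
  push_cast
  rfl

lemma intervalIntegrable_betaIntegrand {z w : ℝ} (hz : 0 < z) (hw : 0 < w) :
    IntervalIntegrable (betaIntegrand z w) volume 0 1 := by
  have h := Complex.betaIntegral_convergent (u := z) (v := w) (by simpa) (by simpa)
  rw [intervalIntegrable_iff_integrableOn_Ioc_of_le zero_le_one] at h ⊢
  refine IntegrableOn.congr_fun h.re (fun u hu ↦ ?_) measurableSet_Ioc
  simp [← ofReal_betaIntegrand z w (Set.Ioc_subset_Icc_self hu)]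

lemma integral_betaIntegrand {z w : ℝ} (hz : 0 < z) (hw : 0 < w) :
    ∫ u in (0 : ℝ)..1, betaIntegrand z w u = betaFn z w := by
  have h := Complex.betaIntegral_eq_Gamma_mul_div z w (by simpa) (by simpa)
  have h' : Complex.betaIntegral z w = ((∫ u in (0 : ℝ)..1, betaIntegrand z w u : ℝ) : ℂ) := by
    rw [← intervalIntegral.integral_ofReal]
    refine intervalIntegral.integral_congr fun u hu ↦ ?_
    rw [Set.uIcc_of_le zero_le_one] at hu
    exact (ofReal_betaIntegrand z w hu).symm
  rw [h', ← Complex.ofReal_add, Complex.Gamma_ofReal, Complex.Gamma_ofReal,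
    Complex.Gamma_ofReal] at h
  exact_mod_cast h

lemma betaFn_pos {z w : ℝ} (hz : 0 < z) (hw : 0 < w) : 0 < betaFn z w :=
  ProbabilityTheory.beta_pos hz hw

lemma regIncBeta_eq (x z w : ℝ) :
    regIncBeta x z w = (∫ u in (0 : ℝ)..x, betaIntegrand z w u) / betaFn z w := rfl

lemma regIncBeta_one {z w : ℝ} (hz : 0 < z) (hw : 0 < w) : regIncBeta 1 z w = 1 := by
  rw [regIncBeta_eq, integral_betaIntegrand hz hw, div_self (betaFn_pos hz hw).ne']

lemma continuousOn_regIncBeta {z w : ℝ} (hz : 0 < z) (hw : 0 < w) :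
    ContinuousOn (fun x ↦ regIncBeta x z w) (Set.Icc 0 1) := by
  simp only [regIncBeta_eq]
  rw [← Set.uIcc_of_le zero_le_one]
  exact (intervalIntegral.continuousOn_primitive_interval'
    (intervalIntegrable_betaIntegrand hz hw) Set.left_mem_uIcc).div_const _

lemma hasDerivAt_regIncBeta {z w x : ℝ} (hz : 0 < z) (hw : 0 < w) (hx : x ∈ Set.Ioo (0 : ℝ) 1) :
    HasDerivAt (fun x ↦ regIncBeta x z w) (betaIntegrand z w x / betaFn z w) x := by
  simp only [regIncBeta_eq]
  refine (intervalIntegral.integral_hasDerivAt_right ?_ ?_ ?_).div_const _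
  · refine (intervalIntegrable_betaIntegrand hz hw).mono_set ?_
    rw [Set.uIcc_of_le hx.1.le, Set.uIcc_of_le zero_le_one]
    exact Set.Icc_subset_Icc_right hx.2.le
  · have : Measurable (betaIntegrand z w) := by unfold betaIntegrand; fun_prop
    exact this.stronglyMeasurable.stronglyMeasurableAtFilter
  · exact (continuousAt_id.rpow_const (Or.inl hx.1.ne')).mul
      ((continuousAt_const.sub continuousAt_id).rpow_const (Or.inl (sub_pos.2 hx.2).ne'))

/-- Integration by parts: Mellin transform of the complementary regularized Beta function. -/
lemma integral_rpow_mul_one_sub_regIncBeta {z w s : ℝ} (hz : 0 < z) (hw : 0 < w) (hs : 0 < s) :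
    ∫ u in (0 : ℝ)..1, u ^ (s - 1) * (1 - regIncBeta u z w)
      = betaFn (z + s) w / (s * betaFn z w) := by
  have hint₁ : IntervalIntegrable (fun u ↦ u ^ (s - 1) * (1 - regIncBeta u z w)) volume 0 1 := by
    refine (intervalIntegral.intervalIntegrable_rpow' (by linarith)).mul_continuousOn ?_
    rw [Set.uIcc_of_le zero_le_one]
    exact continuousOn_const.sub (continuousOn_regIncBeta hz hw)
  have hint₂ : IntervalIntegrable
      (fun u ↦ betaIntegrand (z + s) w u / (s * betaFn z w)) volume 0 1 :=
    (intervalIntegrable_betaIntegrand (by linarith) hw).div_const _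
  have hparts := intervalIntegral.integral_eq_sub_of_hasDerivAt_of_le zero_le_one
    (f := fun u ↦ u ^ s / s * (1 - regIncBeta u z w))
    (f' := fun u ↦ u ^ (s - 1) * (1 - regIncBeta u z w)
      - betaIntegrand (z + s) w u / (s * betaFn z w)) ?_ ?_ (hint₁.sub hint₂)
  · rw [intervalIntegral.integral_sub hint₁ hint₂, intervalIntegral.integral_div,
      integral_betaIntegrand (by linarith) hw, regIncBeta_one hz hw, zero_rpow hs.ne'] at hparts
    simp only [sub_self, mul_zero, zero_div, zero_mul] at hparts
    linarith
  · exact ((continuousOn_id.rpow_const fun _ _ ↦ Or.inr hs.le).div_const _).mul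
      (continuousOn_const.sub (continuousOn_regIncBeta hz hw))
  · intro u hu
    have hd := ((hasDerivAt_rpow_const (p := s) (Or.inl hu.1.ne')).div_const s).mul
      ((hasDerivAt_regIncBeta hz hw hu).const_sub 1)
    refine hd.congr_deriv ?_
    have hB := (betaFn_pos hz hw).ne'
    have hpow : u ^ (z + s - 1) = u ^ (z - 1) * u ^ s := by
      rw [← rpow_add hu.1]; ring_nf
    simp only [betaIntegrand, hpow]
    field_simp
    ring

lemma integral_rpow_mul_comp_sq (s : ℝ) (f : ℝ → ℝ) :
    ∫ r in (0 : ℝ)..1, r ^ (s - 1) * f (r ^ 2)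
      = (∫ u in (0 : ℝ)..1, u ^ (s / 2 - 1) * f u) / 2 := by
  have h := integral_comp_rpow_Ioi_of_pos (p := 2) two_pos
    (g := (Set.Iic (1 : ℝ)).indicator fun u ↦ u ^ (s / 2 - 1) * f u)
  rw [setIntegral_indicator measurableSet_Iic, Set.Ioi_inter_Iic,
    ← intervalIntegral.integral_of_le zero_le_one] at h
  rw [← h, intervalIntegral.integral_of_le zero_le_one, ← Set.Ioi_inter_Iic,
    ← setIntegral_indicator measurableSet_Iic, ← integral_div]
  refine setIntegral_congr_fun measurableSet_Ioi fun r (hr : 0 < r) ↦ ?_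
  have hiff : r ^ (2 : ℝ) ∈ Set.Iic (1 : ℝ) ↔ r ∈ Set.Iic (1 : ℝ) := by
    simp [sq_le_one_iff₀ hr.le]
  by_cases hr1 : r ∈ Set.Iic (1 : ℝ)
  · have hpow : r ^ (s - 1) = r * r ^ (2 * (s / 2 - 1)) := by
      nth_rewrite 2 [← rpow_one r]
      rw [← rpow_add hr]
      ring_nf
    have htwo : r ^ ((2 : ℝ) - 1) = r := by norm_num
    rw [Set.indicator_of_mem hr1, Set.indicator_of_mem (hiff.2 hr1), smul_eq_mul,
      ← rpow_mul hr.le, hpow, rpow_two, htwo]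
    ring
  · rw [Set.indicator_of_notMem hr1, Set.indicator_of_notMem (mt hiff.1 hr1), smul_zero,
      zero_div]

/-- Polar coordinates for radial functions on the Euclidean unit ball. -/
lemma integral_ball_fun_norm (d : ℕ) (hd : d ≠ 0) (f : ℝ → ℝ) :
    ∫ y in Metric.ball (0 : EuclideanSpace ℝ (Fin d)) 1, f ‖y‖
      = 2 * π ^ ((d : ℝ) / 2) / Gamma ((d : ℝ) / 2)
        * ∫ r in (0 : ℝ)..1, r ^ ((d : ℝ) - 1) * f r := by
  have : NeZero d := ⟨hd⟩
  have hG : 0 < Gamma ((d : ℝ) / 2) := Gamma_pos_of_pos (by positivity)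
  have h := integral_fun_norm_addHaar (volume : Measure (EuclideanSpace ℝ (Fin d)))
    ((Set.Iio (1 : ℝ)).indicator f)
  have hball : (fun y : EuclideanSpace ℝ (Fin d) ↦ (Set.Iio (1 : ℝ)).indicator f ‖y‖)
      = (Metric.ball 0 1).indicator fun y ↦ f ‖y‖ := by
    ext y
    by_cases hy : ‖y‖ < 1
    · rw [Set.indicator_of_mem (Set.mem_Iio.2 hy), Set.indicator_of_mem (by simpa using hy)]
    · rw [Set.indicator_of_notMem (by simpa using hy), Set.indicator_of_notMem (by simpa using hy)]
  have hrad : ∫ r in Set.Ioi (0 : ℝ), r ^ (d - 1) • (Set.Iio (1 : ℝ)).indicator f r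
      = ∫ r in (0 : ℝ)..1, r ^ ((d : ℝ) - 1) * f r := by
    simp only [← Set.indicator_smul_apply (Set.Iio (1 : ℝ)) (fun r : ℝ ↦ r ^ (d - 1))]
    rw [setIntegral_indicator measurableSet_Iio, Set.Ioi_inter_Iio,
      intervalIntegral.integral_of_le zero_le_one, integral_Ioc_eq_integral_Ioo]
    refine setIntegral_congr_fun measurableSet_Ioo fun r hr ↦ ?_
    simp only [smul_eq_mul]
    rw [← rpow_natCast, Nat.cast_pred (Nat.pos_of_ne_zero hd)]
  have hvol : d * (volume : Measure (EuclideanSpace ℝ (Fin d))).real (Metric.ball 0 1)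
      = 2 * π ^ ((d : ℝ) / 2) / Gamma ((d : ℝ) / 2) := by
    rw [Measure.real, EuclideanSpace.volume_ball, Fintype.card_fin, Gamma_add_one (by positivity)]
    simp only [ENNReal.ofReal_one, one_pow, one_mul]
    rw [ENNReal.toReal_ofReal (by positivity), sqrt_eq_rpow, ← rpow_mul_natCast pi_pos.le,
      one_div_mul_eq_div]
    field_simp
  rw [hball, integral_indicator measurableSet_ball, finrank_euclideanSpace_fin, hrad,
    nsmul_eq_mul, smul_eq_mul, ← mul_assoc, hvol] at h
  exact h

theorem stmt13 (d : ℕ) (hd : 2 ≤ d) (α : ℝ) (hα : α ∈ Set.Ioo (0:ℝ) 2) :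
    (∫ y in Metric.ball (0 : EuclideanSpace ℝ (Fin d)) 1,
        ‖y‖ ^ (α - (d:ℝ)) * (1 - regIncBeta (‖y‖^2) ((d:ℝ)/2 - α/2) (α/2)))
      = 2 * Real.pi ^ ((d:ℝ)/2) / Real.Gamma ((d:ℝ)/2)
          * (∫ r in (0:ℝ)..1, r ^ (α - 1) * (1 - regIncBeta (r^2) ((d:ℝ)/2 - α/2) (α/2))) ∧
    (∫ y in Metric.ball (0 : EuclideanSpace ℝ (Fin d)) 1,
        ‖y‖ ^ (α - (d:ℝ)) * (1 - regIncBeta (‖y‖^2) ((d:ℝ)/2 - α/2) (α/2)))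
      = 2 * Real.pi ^ ((d:ℝ)/2) / Real.Gamma ((d:ℝ)/2)
          * (Real.Gamma ((d:ℝ)/2) ^ 2
              / (α * Real.Gamma ((d:ℝ)/2 - α/2) * Real.Gamma ((d:ℝ)/2 + α/2))) := by
  have hα0 : 0 < α := hα.1
  have hd' : (2 : ℝ) ≤ d := by exact_mod_cast hd
  have hz : 0 < (d : ℝ) / 2 - α / 2 := by linarith [hα.2]
  have hw : 0 < α / 2 := by linarith
  have hpolar := integral_ball_fun_norm d (by omega) fun r ↦
    r ^ (α - (d : ℝ)) * (1 - regIncBeta (r ^ 2) ((d : ℝ) / 2 - α / 2) (α / 2))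
  have hrad : ∫ r in (0 : ℝ)..1, r ^ ((d : ℝ) - 1)
        * (r ^ (α - (d : ℝ)) * (1 - regIncBeta (r ^ 2) ((d : ℝ) / 2 - α / 2) (α / 2)))
      = ∫ r in (0 : ℝ)..1,
        r ^ (α - 1) * (1 - regIncBeta (r ^ 2) ((d : ℝ) / 2 - α / 2) (α / 2)) := by
    simp only [intervalIntegral.integral_of_le zero_le_one]
    refine setIntegral_congr_fun measurableSet_Ioc fun r hr ↦ ?_
    simp only [← mul_assoc, ← rpow_add hr.1]
    ring_nf
  rw [hrad] at hpolar
  refine ⟨hpolar, ?_⟩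
  rw [hpolar, integral_rpow_mul_comp_sq α
      fun u ↦ 1 - regIncBeta u ((d : ℝ) / 2 - α / 2) (α / 2),
    integral_rpow_mul_one_sub_regIncBeta hz hw hw, betaFn, betaFn, sub_add_cancel]
  have hG₁ := (Gamma_pos_of_pos hz).ne'
  have hG₂ := (Gamma_pos_of_pos hw).ne'
  have hG₃ := (Gamma_pos_of_pos (show 0 < (d : ℝ) / 2 by linarith)).ne'
  have hG₄ := (Gamma_pos_of_pos (show 0 < (d : ℝ) / 2 + α / 2 by linarith)).ne'
  generalize Gamma ((d : ℝ) / 2 - α / 2) = G₁ at *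
  generalize Gamma (α / 2) = G₂ at *
  generalize Gamma ((d : ℝ) / 2) = G₃ at *
  generalize Gamma ((d : ℝ) / 2 + α / 2) = G₄ at *
  field_simp
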